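/- Let T be an orthogonal transformation of ℝ^{p,q} such that for every vector x with B(x,x) ≠ 0, the vector T(x) − x is nonzero and isotropic (B(T(x)−x, T(x)−x) = 0). Then T is the composition of at most p+q reflections with respect to hyperplanes: there exist k ≤ p+q and invertible vectors s_1, …, s_k with T = φ_{s_1} ∘ ⋯ ∘ φ_{s_k}. -/

import Mathlib

/-- The standard bilinear form of signature `(p, q)` on `ℝ^(p+q)`:
`B x y = ∑_{i < p} x i * y i - ∑_{p ≤ i < p+q} x i * y i`. -/
noncomputable def Bpq (p q : ℕ) : LinearMap.BilinForm ℝ (Fin (p + q) → ℝ) :=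
  LinearMap.mk₂ ℝ
    (fun x y => ∑ i : Fin (p + q), (if i.val < p then (1 : ℝ) else -1) * (x i * y i))
    (fun x x' y => by simp [add_mul, mul_add, Finset.sum_add_distrib])
    (fun c x y => by simp [Finset.mul_sum]; congr 1; funext i; ring_nf)
    (fun x y y' => by simp [add_mul, mul_add, Finset.sum_add_distrib])
    (fun c x y => by simp [Finset.mul_sum]; congr 1; funext i; ring_nf)

/-- The reflection with respect to the hyperplane orthogonal to `s`:
`φ_s x = x - (2 * B x s / B s s) • s`. -/
noncomputable def reflpq (p q : ℕ) (s x : Fin (p + q) → ℝ) : Fin (p + q) → ℝ :=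
  x - (2 * Bpq p q x s / Bpq p q s s) • s

lemma Bpq_apply' (p q : ℕ) (x y : Fin (p + q) → ℝ) :
    Bpq p q x y = ∑ i : Fin (p + q), (if i.val < p then (1 : ℝ) else -1) * (x i * y i) := rfl

lemma Bpq_symm' (p q : ℕ) (x y : Fin (p + q) → ℝ) : Bpq p q x y = Bpq p q y x := by
  simp only [Bpq_apply']
  refine Finset.sum_congr rfl fun i _ => ?_
  ring

lemma Bpq_single' (p q : ℕ) (x : Fin (p + q) → ℝ) (i : Fin (p + q)) :
    Bpq p q x (Pi.single i 1) = (if i.val < p then (1 : ℝ) else -1) * x i := by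
  rw [Bpq_apply', Finset.sum_eq_single i]
  · simp
  · intro j _ hj
    simp [hj]
  · simp

lemma Bpq_nondeg' (p q : ℕ) (x : Fin (p + q) → ℝ) (h : ∀ y, Bpq p q x y = 0) : x = 0 := by
  funext i
  have := h (Pi.single i 1)
  rw [Bpq_single'] at this
  split_ifs at this <;> simpa using this

/-- An Eichler transformation with anisotropic `v ⟂ e` is a product of two reflections. -/
lemma eichler_two (p q : ℕ) (e v z : Fin (p + q) → ℝ) (he : Bpq p q e e = 0)
    (hev : Bpq p q e v = 0) (hv : Bpq p q v v ≠ 0) :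
    reflpq p q v (reflpq p q (v + (Bpq p q v v / 2) • e) z) =
      z + Bpq p q z e • v - Bpq p q z v • e - (Bpq p q v v / 2 * Bpq p q z e) • e := by
  have hve : Bpq p q v e = 0 := by rw [Bpq_symm']; exact hev
  have hQ : Bpq p q (v + (Bpq p q v v / 2) • e) (v + (Bpq p q v v / 2) • e) = Bpq p q v v := by
    simp [he, hev, hve]
  unfold reflpq
  rw [hQ]
  generalize hQ' : Bpq p q v v = Q at *
  simp only [map_add, map_sub, map_smul, LinearMap.add_apply, LinearMap.sub_apply,
    LinearMap.smul_apply, smul_eq_mul, hev, hQ']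
  funext i
  simp only [Pi.add_apply, Pi.sub_apply, Pi.smul_apply, smul_eq_mul]
  field_simp
  ring

lemma eichler_aniso (p q : ℕ) (e a : Fin (p + q) → ℝ) (he : Bpq p q e e = 0)
    (hea : Bpq p q e a = 0) :
    Bpq p q (a + (Bpq p q a a / 2) • e) (a + (Bpq p q a a / 2) • e) = Bpq p q a a := by
  have hve : Bpq p q a e = 0 := by rw [Bpq_symm']; exact hea
  simp [he, hea, hve]

lemma four_refl (p q : ℕ) (e f x : Fin (p + q) → ℝ) (he : Bpq p q e e = 0)
    (hf : Bpq p q f f = 0) (hef : Bpq p q e f = 0) (hex : Bpq p q e x = 0)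
    (hfx : Bpq p q f x = -1) :
    ∃ L : List (Fin (p + q) → ℝ), L.length = 4 ∧ (∀ s ∈ L, Bpq p q s s ≠ 0) ∧
      ∀ z, (L.map (reflpq p q)).foldr (· ∘ ·) id z = z + Bpq p q e z • f - Bpq p q f z • e := by
  obtain ⟨a, hea, hfa, haa⟩ : ∃ a, Bpq p q e a = 0 ∧ Bpq p q f a = -1 ∧ Bpq p q a a = 1 := by
    refine ⟨x + ((Bpq p q x x - 1) / 2) • f, ?_, ?_, ?_⟩
    · simp [hef, hex]
    · simp [hf, hfx]
    · have : Bpq p q x f = -1 := by rw [Bpq_symm']; exact hfx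
      simp [hf, hfx, this]
      ring
  have haf : Bpq p q a f = -1 := by rw [Bpq_symm']; exact hfa
  have hae : Bpq p q a e = 0 := by rw [Bpq_symm']; exact hea
  have hfe : Bpq p q f e = 0 := by rw [Bpq_symm']; exact hef
  obtain ⟨b, hb⟩ : ∃ b, b = f - a := ⟨_, rfl⟩
  have hbb : Bpq p q b b = 3 := by
    rw [hb]; simp [hf, haf, hfa, haa]; norm_num
  have heb : Bpq p q e b = 0 := by rw [hb]; simp [hef, hea]
  refine ⟨[a, a + (Bpq p q a a / 2) • e, b, b + (Bpq p q b b / 2) • e], rfl, ?_, ?_⟩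
  · intro s hs
    simp only [List.mem_cons, List.not_mem_nil, or_false] at hs
    rcases hs with rfl | rfl | rfl | rfl
    · rw [haa]; norm_num
    · rw [eichler_aniso p q e a he hea, haa]; norm_num
    · rw [hbb]; norm_num
    · rw [eichler_aniso p q e b he heb, hbb]; norm_num
  · intro z
    simp only [List.map_cons, List.map_nil, List.foldr_cons, List.foldr_nil, Function.comp_apply,
      id_eq]
    rw [eichler_two p q e b z he heb (by rw [hbb]; norm_num),
      eichler_two p q e a _ he hea (by rw [haa]; norm_num), haa, hbb]
    have hba : Bpq p q b a = -2 := by rw [hb]; simp [hfa, haa]; norm_num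
    have hbe : Bpq p q b e = 0 := by rw [Bpq_symm']; exact heb
    have h1 : Bpq p q z b = Bpq p q f z - Bpq p q z a := by
      rw [hb, map_sub, Bpq_symm' p q z f]
    simp only [map_add, map_sub, map_smul, LinearMap.add_apply, LinearMap.sub_apply,
      LinearMap.smul_apply, smul_eq_mul, hba, hbe, he, hea, h1, Bpq_symm' p q z e]
    rw [hb]
    funext i
    simp only [Pi.add_apply, Pi.sub_apply, Pi.smul_apply, smul_eq_mul]
    ring

lemma foldr_comp_append {α : Type*} (L M : List (α → α)) (z : α) :
    (L ++ M).foldr (· ∘ ·) id z = L.foldr (· ∘ ·) id (M.foldr (· ∘ ·) id z) := by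
  induction L with
  | nil => simp
  | cons a L ih => simp only [List.cons_append, List.foldr_cons, Function.comp_apply, ih]

lemma skew_prod (p q : ℕ) (r : ℕ) : ∀ (N : (Fin (p + q) → ℝ) →ₗ[ℝ] (Fin (p + q) → ℝ)),
    Module.finrank ℝ (LinearMap.range N) ≤ r →
    (∀ x y, Bpq p q (N x) y = - Bpq p q x (N y)) →
    (∀ x y, Bpq p q (N x) (N y) = 0) →
    ∃ L : List (Fin (p + q) → ℝ), L.length ≤ 2 * Module.finrank ℝ (LinearMap.range N) ∧
      (∀ s ∈ L, Bpq p q s s ≠ 0) ∧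
      ∀ z, (L.map (reflpq p q)).foldr (· ∘ ·) id z = z + N z := by
  induction r using Nat.strong_induction_on with
  | _ r ih =>
  intro N hr hskew hisot
  by_cases hN : ∀ x y, Bpq p q (N x) y = 0
  · refine ⟨[], by simp, by simp, fun z => ?_⟩
    simp [Bpq_nondeg' p q (N z) (hN z)]
  push Not at hN
  obtain ⟨x, y', hxy'⟩ := hN
  obtain ⟨y, hxy⟩ : ∃ y, Bpq p q (N x) y = 1 :=
    ⟨(Bpq p q (N x) y')⁻¹ • y', by simp [hxy']⟩
  have hself : ∀ x, Bpq p q (N x) x = 0 := fun x => by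
    have := hskew x x
    rw [Bpq_symm' p q x] at this
    linarith
  have hyx : Bpq p q (N y) x = -1 := by
    rw [hskew, Bpq_symm', hxy]
  obtain ⟨N₁, hN₁⟩ : ∃ N₁ : (Fin (p + q) → ℝ) →ₗ[ℝ] (Fin (p + q) → ℝ),
      ∀ z, N₁ z = Bpq p q (N x) z • N y - Bpq p q (N y) z • N x :=
    ⟨(Bpq p q (N x)).smulRight (N y) - (Bpq p q (N y)).smulRight (N x), fun z => by simp⟩
  obtain ⟨N', hN'⟩ : ∃ N' : (Fin (p + q) → ℝ) →ₗ[ℝ] (Fin (p + q) → ℝ), N' = N - N₁ := ⟨_, rfl⟩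
  have hN'z : ∀ z, N' z = N (z - Bpq p q (N x) z • y + Bpq p q (N y) z • x) := fun z => by
    rw [hN', LinearMap.sub_apply, hN₁]
    simp only [map_add, map_sub, map_smul]
    abel
  have hskew' : ∀ u v, Bpq p q (N' u) v = - Bpq p q u (N' v) := fun u v => by
    rw [hN', LinearMap.sub_apply, LinearMap.sub_apply, hN₁, hN₁]
    simp only [map_sub, map_smul, LinearMap.sub_apply, LinearMap.smul_apply, smul_eq_mul]
    rw [hskew u v, Bpq_symm' p q u (N x), Bpq_symm' p q u (N y)]
    ring
  have hisot' : ∀ u v, Bpq p q (N' u) (N' v) = 0 := fun u v => by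
    rw [hN'z, hN'z]; exact hisot _ _
  have hx0 : N' x = 0 := by
    rw [hN'z, hself, hyx]; simp
  have hy0 : N' y = 0 := by
    rw [hN'z, hself, hxy]; simp
  have hrank : Module.finrank ℝ (LinearMap.range N') + 2 ≤
      Module.finrank ℝ (LinearMap.range N) := by
    have hpx : ∀ w ∈ LinearMap.range N', Bpq p q w x = 0 := by
      rintro _ ⟨u, rfl⟩; rw [hskew', hx0]; simp
    have hpy : ∀ w ∈ LinearMap.range N', Bpq p q w y = 0 := by
      rintro _ ⟨u, rfl⟩; rw [hskew', hy0]; simp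
    have hle : LinearMap.range N' ≤ LinearMap.range N := by
      rintro _ ⟨u, rfl⟩; rw [hN'z]; exact ⟨_, rfl⟩
    have h1 : LinearMap.range N' < LinearMap.range N' ⊔ Submodule.span ℝ {N x} := by
      refine lt_of_le_of_ne le_sup_left fun h => ?_
      have : N x ∈ LinearMap.range N' := by
        rw [h]; exact Submodule.mem_sup_right (Submodule.mem_span_singleton_self _)
      have := hpy _ this
      rw [hxy] at this; norm_num at this
    have h2 : LinearMap.range N' ⊔ Submodule.span ℝ {N x} < LinearMap.range N := by
      refine lt_of_le_of_ne (sup_le hle ?_) fun h => ?_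
      · rw [Submodule.span_singleton_le_iff_mem]; exact ⟨_, rfl⟩
      · have : N y ∈ LinearMap.range N' ⊔ Submodule.span ℝ {N x} := by
          rw [h]; exact ⟨_, rfl⟩
        obtain ⟨w, hw, u, hu, hwu⟩ := Submodule.mem_sup.1 this
        obtain ⟨c, rfl⟩ := Submodule.mem_span_singleton.1 hu
        have h3 := hyx
        rw [← hwu] at h3
        simp [hpx w hw, hself] at h3
    have := Submodule.finrank_lt_finrank_of_lt h1
    have := Submodule.finrank_lt_finrank_of_lt h2
    omega
  obtain ⟨L', hL'1, hL'2, hL'3⟩ := ih (Module.finrank ℝ (LinearMap.range N')) (by omega) N' le_rfl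
    hskew' hisot'
  obtain ⟨L, hL1, hL2, hL3⟩ := four_refl p q (N x) (N y) x (hisot _ _) (hisot _ _) (hisot _ _)
    (hself x) hyx
  refine ⟨L ++ L', ?_, ?_, ?_⟩
  · rw [List.length_append]; omega
  · intro s hs
    rcases List.mem_append.1 hs with h | h
    · exact hL2 s h
    · exact hL'2 s h
  · intro z
    have e1 : Bpq p q (N x) (N' z) = 0 := by rw [hN'z]; exact hisot _ _
    have e2 : Bpq p q (N y) (N' z) = 0 := by rw [hN'z]; exact hisot _ _
    rw [List.map_append, foldr_comp_append, hL'3, hL3]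
    simp only [map_add, e1, e2, add_zero]
    rw [hN', LinearMap.sub_apply, hN₁]
    abel

/-- if `T` is an orthogonal transformation of `ℝ^{p,q}` such that
`T x - x` is nonzero and isotropic for every nonisotropic `x`, then `T` is the
composition of at most `p + q` hyperplane reflections. -/
theorem stmt_6 (p q : ℕ) (T : (Fin (p + q) → ℝ) →ₗ[ℝ] (Fin (p + q) → ℝ))
    (horth : ∀ x y : Fin (p + q) → ℝ, Bpq p q (T x) (T y) = Bpq p q x y)
    (hiso : ∀ x : Fin (p + q) → ℝ, Bpq p q x x ≠ 0 →
      T x - x ≠ 0 ∧ Bpq p q (T x - x) (T x - x) = 0) :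
    ∃ (k : ℕ) (s : Fin k → (Fin (p + q) → ℝ)), k ≤ p + q ∧
      (∀ i, Bpq p q (s i) (s i) ≠ 0) ∧
      ⇑T = (List.ofFn fun i => reflpq p q (s i)).foldr (· ∘ ·) id := by
  obtain ⟨N, hN⟩ : ∃ N : (Fin (p + q) → ℝ) →ₗ[ℝ] (Fin (p + q) → ℝ), N = T - LinearMap.id :=
    ⟨_, rfl⟩
  have hNz : ∀ z, N z = T z - z := fun z => by rw [hN]; simp
  have hTz : ∀ z, T z = z + N z := fun z => by rw [hNz]; abel
  have hQ0 : ∀ x, Bpq p q x x ≠ 0 → Bpq p q (N x) (N x) = 0 := fun x hx => by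
    rw [hNz]; exact (hiso x hx).2
  have hQ : ∀ x, Bpq p q (N x) (N x) = 0 := by
    intro x
    by_cases hx : Bpq p q x x = 0
    swap
    · exact hQ0 x hx
    by_cases hx0 : x = 0
    · simp [hx0]
    obtain ⟨y, hy⟩ : ∃ y, Bpq p q y y ≠ 0 := by
      obtain ⟨i, _⟩ := Function.ne_iff.1 hx0
      refine ⟨Pi.single i 1, ?_⟩
      rw [Bpq_single']
      split_ifs <;> simp
    have key : ∀ t : ℝ, 0 < t → 0 < t + 2 * (Bpq p q x y / Bpq p q y y) →
        Bpq p q (N x) (N x) + 2 * t * Bpq p q (N x) (N y) = 0 := by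
      intro t ht ht2
      have e1 : Bpq p q (x + t • y) (x + t • y) =
          t * Bpq p q y y * (t + 2 * (Bpq p q x y / Bpq p q y y)) := by
        simp only [map_add, map_smul, LinearMap.add_apply, LinearMap.smul_apply, smul_eq_mul, hx,
          Bpq_symm' p q y x]
        field_simp
        ring
      have e2 := hQ0 (x + t • y) (by
        rw [e1]; exact mul_ne_zero (mul_ne_zero ht.ne' hy) ht2.ne')
      simp only [map_add, map_smul, LinearMap.add_apply, LinearMap.smul_apply, smul_eq_mul,
        Bpq_symm' p q (N y) (N x), hQ0 y hy] at e2
      linarith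
    generalize Bpq p q x y / Bpq p q y y = c at key
    have hc := neg_abs_le c
    have hc' := abs_nonneg c
    have k1 := key (2 * |c| + 1) (by linarith) (by linarith)
    have k2 := key (2 * (2 * |c| + 1)) (by linarith) (by linarith)
    linarith
  have hisot : ∀ x y, Bpq p q (N x) (N y) = 0 := by
    intro x y
    have := hQ (x + y)
    simp only [map_add, LinearMap.add_apply, hQ, Bpq_symm' p q (N y) (N x)] at this
    linarith
  have hskew : ∀ x y, Bpq p q (N x) y = - Bpq p q x (N y) := by
    intro x y
    have := horth x y
    rw [hTz, hTz] at this
    simp only [map_add, LinearMap.add_apply, hisot] at this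
    linarith
  have hrk : 2 * Module.finrank ℝ (LinearMap.range N) ≤ p + q := by
    have h1 : LinearMap.range N ≤ LinearMap.ker N := by
      rintro _ ⟨u, rfl⟩
      rw [LinearMap.mem_ker]
      refine Bpq_nondeg' p q _ fun y => ?_
      rw [hskew, hisot, neg_zero]
    have h2 := Submodule.finrank_mono h1
    have h3 := LinearMap.finrank_range_add_finrank_ker N
    rw [Module.finrank_fin_fun] at h3
    omega
  obtain ⟨L, hL1, hL2, hL3⟩ := skew_prod p q _ N le_rfl hskew hisot
  refine ⟨L.length, fun i => L.get i, by omega, fun i => hL2 _ (List.get_mem _ _), ?_⟩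
  have : (List.ofFn fun i => reflpq p q (L.get i)) = L.map (reflpq p q) := by
    conv_rhs => rw [← List.ofFn_get L, List.map_ofFn]
    rfl
  rw [this]
  funext z
  rw [hL3, hTz]
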